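/- arXiv:2510.21174 — 2 statements merged into one kernel-verified Lean document; each statement's English description precedes it below -/
import Mathlib

section
/- Let K and L be positive integers, d > 0, and let g_1, …, g_L and g'_1, …, g'_L be points in ℝ^K. If the closed ball of radius d centered at the origin is contained in the convex hull of {g_1, …, g_L}, and ‖g'_a − g_a‖ ≤ d/2 for every a = 1, …, L, then the closed ball of radius d/2 centered at the origin is contained in the convex hull of {g'_1, …, g'_L}; in particular, the origin lies in the topological interior of the convex hull of {g'_1, …, g'_L}. -/
/-- Perturbation stability of convex hulls containing a ball: if the closed
ball of radius `d` about the origin is contained in the convex hull of `g 1, …, g L` and each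
`g' a` is within `d / 2` of `g a`, then the closed ball of radius `d / 2` about the origin is
contained in the convex hull of `g' 1, …, g' L`; in particular the origin lies in the interior
of that convex hull. -/
theorem stmt2 {K L : ℕ} (hK : 0 < K) (hL : 0 < L) (d : ℝ) (hd : 0 < d)
    (g g' : Fin L → EuclideanSpace ℝ (Fin K))
    (hball : Metric.closedBall (0 : EuclideanSpace ℝ (Fin K)) d ⊆
      convexHull ℝ (Set.range g))
    (hpert : ∀ a, ‖g' a - g a‖ ≤ d / 2) :
    Metric.closedBall (0 : EuclideanSpace ℝ (Fin K)) (d / 2) ⊆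
      convexHull ℝ (Set.range g') ∧
    (0 : EuclideanSpace ℝ (Fin K)) ∈ interior (convexHull ℝ (Set.range g')) := by
  have key : Metric.closedBall (0 : EuclideanSpace ℝ (Fin K)) (d / 2) ⊆
      convexHull ℝ (Set.range g') := by
    intro x hx
    rw [mem_closedBall_zero_iff] at hx
    by_contra hxn
    obtain ⟨f, u, hf, hu⟩ := geometric_hahn_banach_closed_point (convex_convexHull ℝ (Set.range g'))
      ((Set.finite_range g').isClosed_convexHull ℝ) hxn
    obtain ⟨v, hv⟩ : ∃ v : EuclideanSpace ℝ (Fin K), ∀ y, f y = inner ℝ v y :=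
      ⟨(InnerProductSpace.toDual ℝ _).symm f, fun y => by simp⟩
    have hv0 := norm_nonneg v
    have hsub : convexHull ℝ (Set.range g) ⊆ {y | f y < u + ‖v‖ * (d / 2)} := by
      apply convexHull_min
      · rintro _ ⟨a, rfl⟩
        have h1 := hf (g' a) (subset_convexHull ℝ _ ⟨a, rfl⟩)
        have h2 : f (g a) = f (g' a) + inner ℝ v (g a - g' a) := by
          rw [← hv, map_sub]; ring
        have h3 := real_inner_le_norm v (g a - g' a)
        have h4 := hpert a
        rw [norm_sub_rev] at h4
        have h5 := mul_le_mul_of_nonneg_left h4 hv0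
        simp only [Set.mem_ofPred_eq]
        linarith
      · exact convex_halfSpace_lt f.toLinearMap.isLinear _
    have hy : (d / ‖v‖) • v ∈ Metric.closedBall (0 : EuclideanSpace ℝ (Fin K)) d := by
      rw [mem_closedBall_zero_iff, norm_smul, Real.norm_of_nonneg (by positivity)]
      rcases eq_or_ne ‖v‖ 0 with h | h
      · simp [h, hd.le]
      · exact (div_mul_cancel₀ d h).le
    have h6 : f ((d / ‖v‖) • v) < u + ‖v‖ * (d / 2) := hsub (hball hy)
    have h7 : f ((d / ‖v‖) • v) = d * ‖v‖ := by
      rw [hv, real_inner_smul_right, real_inner_self_eq_norm_sq]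
      rcases eq_or_ne ‖v‖ 0 with h | h
      · simp [h]
      · field_simp
    have h8 := real_inner_le_norm v x
    have h9 := mul_le_mul_of_nonneg_left hx hv0
    rw [hv] at hu
    linarith
  exact ⟨key, mem_interior_iff_mem_nhds.2
    (Filter.mem_of_superset (Metric.closedBall_mem_nhds _ (half_pos hd)) key)⟩
end

section
/- Let ψ : ℝ^p → ℝ be twice continuously differentiable, let θ̂ ∈ ℝ^p satisfy ∇ψ(θ̂) = 0, and let θ⁰ ∈ ℝ^p be such that Hess ψ(θ⁰) is invertible. Suppose the Hessian of ψ is L-Lipschitz in operator norm on the closed segment joining θ⁰ and θ̂, and that ‖θ⁰ − θ̂‖ ≤ 2 / (L · ‖(Hess ψ(θ⁰))⁻¹‖_op). Then the Newton–Raphson update θ¹ = θ⁰ − (Hess ψ(θ⁰))⁻¹ ∇ψ(θ⁰) satisfies ‖θ¹ − θ̂‖ ≤ ‖θ⁰ − θ̂‖. -/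
/-- Newton–Raphson stability region: if `ψ : ℝ^p → ℝ` is `C²`, `θ̂` is a
critical point (`∇ψ(θ̂) = 0`), the Hessian `H₀ = Dψ'(θ⁰)` (the derivative of the gradient
at `θ⁰`) is invertible, the Hessian is `L`-Lipschitz in operator norm on the segment joining
`θ⁰` and `θ̂`, and `‖θ⁰ - θ̂‖ ≤ 2 / (L ‖H₀⁻¹‖)`, then the Newton update
`θ¹ = θ⁰ - H₀⁻¹ ∇ψ(θ⁰)` satisfies `‖θ¹ - θ̂‖ ≤ ‖θ⁰ - θ̂‖`. -/
theorem stmt13 {p : ℕ} (ψ : EuclideanSpace ℝ (Fin p) → ℝ) (hψ : ContDiff ℝ 2 ψ)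
    (θhat θ0 : EuclideanSpace ℝ (Fin p))
    (hcrit : gradient ψ θhat = 0)
    (H0 : EuclideanSpace ℝ (Fin p) ≃L[ℝ] EuclideanSpace ℝ (Fin p))
    (hH0 : (H0 : EuclideanSpace ℝ (Fin p) →L[ℝ] EuclideanSpace ℝ (Fin p))
      = fderiv ℝ (gradient ψ) θ0)
    (L : ℝ)
    (hLip : ∀ x ∈ segment ℝ θ0 θhat, ∀ y ∈ segment ℝ θ0 θhat,
      ‖fderiv ℝ (gradient ψ) x - fderiv ℝ (gradient ψ) y‖ ≤ L * ‖x - y‖)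
    (hclose : ‖θ0 - θhat‖
      ≤ 2 / (L * ‖(H0.symm : EuclideanSpace ℝ (Fin p) →L[ℝ] EuclideanSpace ℝ (Fin p))‖)) :
    ‖(θ0 - H0.symm (gradient ψ θ0)) - θhat‖ ≤ ‖θ0 - θhat‖ := by
  have hgd : Differentiable ℝ (gradient ψ) := by
    have h1 : Differentiable ℝ (fderiv ℝ ψ) :=
      (hψ.fderiv_right (m := 1) (by norm_num)).differentiable (by norm_num)
    exact (InnerProductSpace.toDual ℝ
      (EuclideanSpace ℝ (Fin p))).symm.toContinuousLinearEquiv.differentiable.comp h1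
  by_cases heq : θ0 = θhat
  · subst heq
    simp [hcrit]
  have hd : 0 < ‖θ0 - θhat‖ := norm_pos_iff.mpr (sub_ne_zero.mpr heq)
  set N := ‖(H0.symm : EuclideanSpace ℝ (Fin p) →L[ℝ] EuclideanSpace ℝ (Fin p))‖ with hN
  have hLN : 0 < L * N := by
    by_contra hcon
    have : 2 / (L * N) ≤ 0 := div_nonpos_of_nonneg_of_nonpos (by norm_num) (not_lt.mp hcon)
    linarith
  rw [le_div_iff₀ hLN] at hclose
  set v := θhat - θ0 with hv
  have hvn : ‖v‖ = ‖θ0 - θhat‖ := norm_sub_rev _ _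
  have hline : ∀ t : ℝ, HasDerivAt (fun t : ℝ => θ0 + t • v) v t := fun t => by
    simpa using ((hasDerivAt_id t).smul_const v).const_add θ0
  have hf : ∀ t : ℝ, HasDerivAt
      (fun t : ℝ => gradient ψ (θ0 + t • v) - gradient ψ θ0 - t • H0 v)
      (fderiv ℝ (gradient ψ) (θ0 + t • v) v - H0 v) t := fun t => by
    have h1 := (hgd (θ0 + t • v)).hasFDerivAt.comp_hasDerivAt t (hline t)
    have h2 : HasDerivAt (fun t : ℝ => t • H0 v) (H0 v) t := by
      simpa using (hasDerivAt_id t).smul_const (H0 v)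
    exact (h1.sub_const _).sub h2
  have hB : ∀ t : ℝ, HasDerivAt (fun t : ℝ => L * ‖v‖ ^ 2 / 2 * t ^ 2) (L * ‖v‖ ^ 2 * t) t :=
    fun t => by
      have := (hasDerivAt_pow 2 t).const_mul (L * ‖v‖ ^ 2 / 2)
      refine this.congr_deriv ?_
      norm_num
      ring
  have hmain := image_norm_le_of_norm_deriv_right_le_deriv_boundary
    (a := (0 : ℝ)) (b := 1)
    (fun t _ => (hf t).continuousAt.continuousWithinAt)
    (fun t _ => (hf t).hasDerivWithinAt) (by simp) hB
    (fun t ht => by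
      have hmem : θ0 + t • v ∈ segment ℝ θ0 θhat := by
        rw [segment_eq_image']
        exact ⟨t, ⟨ht.1, ht.2.le⟩, rfl⟩
      have h1 := hLip _ hmem θ0 (left_mem_segment ℝ θ0 θhat)
      rw [← hH0, add_sub_cancel_left, norm_smul, Real.norm_of_nonneg ht.1] at h1
      have h2 := (fderiv ℝ (gradient ψ) (θ0 + t • v) -
        (H0 : EuclideanSpace ℝ (Fin p) →L[ℝ] EuclideanSpace ℝ (Fin p))).le_opNorm v
      have h3 := mul_le_mul_of_nonneg_right h1 (norm_nonneg v)
      calc _ ≤ _ := h2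
        _ ≤ _ := h3
        _ = _ := by ring)
    (Set.right_mem_Icc.mpr zero_le_one)
  have e1 : θ0 + v = θhat := by simp [hv]
  simp only [one_smul, e1, hcrit] at hmain
  have e2 : θ0 - H0.symm (gradient ψ θ0) - θhat
      = H0.symm (0 - gradient ψ θ0 - H0 v) := by
    simp only [map_sub, map_zero, ContinuousLinearEquiv.symm_apply_apply, hv]
    abel
  rw [e2]
  have h4 := (H0.symm : EuclideanSpace ℝ (Fin p) →L[ℝ] EuclideanSpace ℝ (Fin p)).le_opNorm
    (0 - gradient ψ θ0 - H0 v)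
  have h5 := mul_le_mul_of_nonneg_left hmain (norm_nonneg
    (H0.symm : EuclideanSpace ℝ (Fin p) →L[ℝ] EuclideanSpace ℝ (Fin p)))
  refine (h4.trans h5).trans ?_
  rw [← hN, hvn]
  nlinarith
end
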